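/- Let A be an abelian length category and Y an indecomposable object that is not simple. Then there exists a short exact sequence 0 → X → Y → Z → 0 in A with both X and Z indecomposable. -/

import Mathlib

open CategoryTheory CategoryTheory.Limits

/-- The lexicographic order on finite subsets of ℕ:
`X ≤ Y` iff `min (Y \ X) ≤ min (X \ Y)`, with `min ∅ = ⊤`. -/
def lexLE (X Y : Finset ℕ) : Prop :=
  (Y \ X).min ≤ (X \ Y).min

/-- Strict lexicographic order. -/
def lexLT (X Y : Finset ℕ) : Prop :=
  lexLE X Y ∧ ¬ lexLE Y X

variable {C : Type*} [Category C] [Abelian C]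

/-- `n` is the composition length of the object `X`: there is a maximal
strictly increasing chain of subobjects of `X` from `⊥` to `⊤` with `n`
steps, and every strictly increasing chain of subobjects has at most
`n` steps. -/
def ObjLength (X : C) (n : ℕ) : Prop :=
  (∃ f : Fin (n + 1) → Subobject X, StrictMono f ∧ f 0 = ⊥ ∧ f (Fin.last n) = ⊤) ∧
  ∀ (m : ℕ) (f : Fin (m + 1) → Subobject X), StrictMono f → m ≤ n

/-- `A` is the set of lengths of a finite chain of indecomposable subobjects
of `X` ending in `X` itself. -/
def IsGRChainVal (len : C → ℕ) (X : C) (A : Finset ℕ) : Prop :=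
  ∃ s : Finset (Subobject X),
    IsChain (· ≤ ·) (s : Set (Subobject X)) ∧
    (⊤ : Subobject X) ∈ s ∧
    (∀ t ∈ s, Indecomposable ((t : Subobject X) : C)) ∧
    s.image (fun t : Subobject X => len ((t : Subobject X) : C)) = A

/-- `mu` is the Gabriel-Roiter measure associated to the length function
`len`: for each indecomposable `X`, `mu X` is the lexicographic maximum of
the sets of lengths along chains of indecomposable subobjects of `X`. -/
def IsGRMeasure (len : C → ℕ) (mu : C → Finset ℕ) : Prop :=
  ∀ X : C, Indecomposable X →
    IsGRChainVal len X (mu X) ∧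
    ∀ A : Finset ℕ, IsGRChainVal len X A → lexLE A (mu X)

/-- `X` is a Gabriel-Roiter predecessor of `Y`: both are indecomposable,
`X` is a proper subobject of `Y`, and `mu X` attains the maximum of the
Gabriel-Roiter measures of the proper indecomposable subobjects of `Y`. -/
def IsGRPred (mu : C → Finset ℕ) (X Y : C) : Prop :=
  Indecomposable X ∧ Indecomposable Y ∧
  (∃ f : X ⟶ Y, Mono f ∧ ¬ IsIso f) ∧
  ∀ t : Subobject Y, t ≠ ⊤ → Indecomposable ((t : Subobject Y) : C) →
    lexLE (mu ((t : Subobject Y) : C)) (mu X)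

section Helpers

theorem gr_strictMono_map {X Y : C} (f : X ⟶ Y) [Mono f] :
    StrictMono (Subobject.map f).obj :=
  (Subobject.map f).monotone.strictMono_of_injective (Subobject.map_obj_injective f)

theorem gr_map_lt_top {D : Type*} [Category D] {X Y : D} (f : X ⟶ Y) [Mono f]
    (hf : ¬ IsIso f) (s : Subobject X) : (Subobject.map f).obj s < ⊤ := by
  rw [lt_top_iff_ne_top]
  intro h
  apply hf
  have h1 : (Subobject.map f).obj s ≤ (Subobject.map f).obj ⊤ :=
    (Subobject.map f).monotone le_top
  rw [h, Subobject.map_top] at h1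
  exact (Subobject.isIso_iff_mk_eq_top f).2 (top_le_iff.1 h1)

theorem gr_len_mono {X Y : C} {m n : ℕ} (hX : ObjLength X m) (hY : ObjLength Y n)
    (f : X ⟶ Y) [Mono f] : m ≤ n ∧ (n ≤ m → IsIso f) := by
  obtain ⟨⟨c, hc, -, -⟩, -⟩ := hX
  refine ⟨hY.2 m _ ((gr_strictMono_map f).comp hc), fun hnm => ?_⟩
  by_contra hf
  let p : LTSeries (Subobject Y) := (LTSeries.mk m c hc).map _ (gr_strictMono_map f)
  let q : LTSeries (Subobject Y) := p.snoc ⊤ (gr_map_lt_top f hf _)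
  have h := hY.2 q.length q.toFun q.strictMono
  have hq : q.length = m + 1 := by simp [q, p, LTSeries.map]
  omega

theorem gr_len_epi {X Y : C} {m n : ℕ} (hX : ObjLength X m) (hY : ObjLength Y n)
    (f : X ⟶ Y) [Epi f] : n ≤ m ∧ (m ≤ n → IsIso f) := by
  obtain ⟨⟨c, hc, -, -⟩, -⟩ := hY
  let eX := Abelian.subobjectIsoSubobjectOp X
  let eY := Abelian.subobjectIsoSubobjectOp Y
  let φ : Subobject Y → Subobject X := fun s =>
    eX.symm (OrderDual.toDual ((Subobject.map f.op).obj (OrderDual.ofDual (eY s))))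
  have hφ : StrictMono φ := by
    intro a b hab
    apply eX.symm.strictMono
    rw [OrderDual.toDual_lt_toDual]
    apply (Subobject.map f.op).monotone.strictMono_of_injective
      (Subobject.map_obj_injective f.op)
    exact OrderDual.ofDual_lt_ofDual.2 (eY.strictMono hab)
  refine ⟨hX.2 n _ (hφ.comp hc), fun hnm => ?_⟩
  by_contra hf
  have hf' : ¬ IsIso f.op := fun h => hf ((isIso_op_iff f).1 h)
  have hbot : ∀ s, ⊥ < φ s := by
    intro s
    have h0 : (⊥ : Subobject X) = eX.symm ⊥ := eX.symm.map_bot.symm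
    rw [h0]
    apply eX.symm.strictMono
    have hlt := gr_map_lt_top f.op hf' (OrderDual.ofDual (eY s))
    exact (OrderDual.toDual_lt_toDual (α := Subobject (Opposite.op X))).2 hlt
  let p : LTSeries (Subobject X) := (LTSeries.mk n c hc).map _ hφ
  let q : LTSeries (Subobject X) := p.cons ⊥ (hbot _)
  have h := hX.2 q.length q.toFun q.strictMono
  have hq : q.length = n + 1 := by simp [q, p, LTSeries.map]
  omega

/-- A nonzero split subobject of an indecomposable object is everything. -/
theorem gr_isIso_of_split {A B : C} (hB : Indecomposable B) (i : A ⟶ B) (r : B ⟶ A)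
    (h : i ≫ r = 𝟙 A) (hA : ¬ IsZero A) : IsIso i := by
  have : IsSplitMono i := ⟨⟨⟨r, h⟩⟩⟩
  let hb := isBilimitBinaryBiconeOfIsSplitMonoOfCokernel (cokernelIsCokernel i)
  have e : B ≅ A ⊞ cokernel i := biprod.uniqueUpToIso A (cokernel i) hb
  rcases hB.2 _ _ e with h | h
  · exact absurd h hA
  · have : Epi i := Preadditive.epi_of_isZero_cokernel i h
    exact isIso_of_mono_of_epi i

/-- Lifting along a pullback whose kernel inclusion splits. -/
theorem gr_section {X Y Z Z₁ : C} (x : X ⟶ Y) (p : Y ⟶ Z) (w : x ≫ p = 0)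
    (hS : (ShortComplex.mk x p w).ShortExact) (i : Z₁ ⟶ Z)
    (r : pullback p i ⟶ X) (hr : pullback.lift x 0 (by simp [w]) ≫ r = 𝟙 X) :
    ∃ σ : Z₁ ⟶ Y, σ ≫ p = i := by
  have : Epi p := hS.epi_g
  have : Mono x := hS.mono_f
  let a : X ⟶ pullback p i := pullback.lift x 0 (by simp [w])
  have ha1 : a ≫ pullback.fst p i = x := pullback.lift_fst _ _ _
  have ha2 : a ≫ pullback.snd p i = 0 := pullback.lift_snd _ _ _
  let T := ShortComplex.mk a (pullback.snd p i) ha2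
  have hT : T.Exact := by
    apply ShortComplex.exact_of_f_is_kernel
    have key : ∀ {W : C} (k : W ⟶ pullback p i) (hk : k ≫ pullback.snd p i = 0),
        (k ≫ pullback.fst p i) ≫ p = 0 := by
      intro W k hk
      rw [Category.assoc, pullback.condition, reassoc_of% hk, zero_comp]
    refine KernelFork.IsLimit.ofι _ _
      (fun k hk => hS.exact.lift (k ≫ pullback.fst p i) (key k hk)) ?_ ?_
    · intro W k hk
      apply pullback.hom_ext
      · change (_ ≫ a) ≫ _ = _
        rw [Category.assoc, ha1]
        exact hS.exact.lift_f _ _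
      · change (_ ≫ a) ≫ _ = _
        rw [Category.assoc, ha2, hk, comp_zero]
    · intro W k hk m hm
      rw [← cancel_mono x]
      refine Eq.trans ?_ (hS.exact.lift_f (k ≫ pullback.fst p i) (key k hk)).symm
      rw [← hm]
      change _ = (_ ≫ a) ≫ _
      rw [Category.assoc, ha1]
  have hsp : T.Splitting := ShortComplex.Splitting.ofExactOfRetraction T hT r hr
    (by change Epi (pullback.snd p i); infer_instance)
  refine ⟨hsp.s ≫ pullback.fst p i, ?_⟩
  have := hsp.s_g
  change hsp.s ≫ pullback.snd p i = 𝟙 _ at this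
  rw [Category.assoc, pullback.condition, reassoc_of% this]

theorem gr_not_iso_inl {A B : C} (hB : ¬ IsZero B) : ¬ Epi (biprod.inl : A ⟶ A ⊞ B) := by
  intro h
  apply hB
  have : (biprod.snd : A ⊞ B ⟶ B) = 0 := by
    rw [← cancel_epi (biprod.inl : A ⟶ A ⊞ B)]; simp
  rw [IsZero.iff_id_eq_zero, ← biprod.inr_snd (X := A), this, comp_zero]

theorem gr_not_iso_inr {A B : C} (hA : ¬ IsZero A) : ¬ Epi (biprod.inr : B ⟶ A ⊞ B) := by
  intro h
  apply hA
  have : (biprod.fst : A ⊞ B ⟶ A) = 0 := by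
    rw [← cancel_epi (biprod.inr : B ⟶ A ⊞ B)]; simp
  rw [IsZero.iff_id_eq_zero, ← biprod.inl_fst (Y := B), this, comp_zero]

/-- A nonzero map into an object is nonzero on some indecomposable summand. -/
theorem gr_summand (len : C → ℕ) (hlen : ∀ X, ObjLength X (len X)) (n : ℕ) :
    ∀ (W T : C) (s : T ⟶ W), len W ≤ n → s ≠ 0 →
      ∃ (U : C) (i : U ⟶ W) (p : W ⟶ U), i ≫ p = 𝟙 U ∧ Indecomposable U ∧ s ≫ p ≠ 0 := by
  induction n using Nat.strong_induction_on with
  | _ n ih =>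
    intro W T s hW hs
    by_cases hI : Indecomposable W
    · exact ⟨W, 𝟙 W, 𝟙 W, by simp, hI, by simpa using hs⟩
    have hW0 : ¬ IsZero W := fun h => hs (h.eq_of_tgt _ _)
    unfold Indecomposable at hI
    push Not at hI
    obtain ⟨A, B, e, hA, hB⟩ := hI hW0
    have main : ∀ (A : C) (i : A ⟶ W) (p : W ⟶ A), i ≫ p = 𝟙 A → ¬ IsIso i → s ≫ p ≠ 0 →
        ∃ (U : C) (i : U ⟶ W) (p : W ⟶ U), i ≫ p = 𝟙 U ∧ Indecomposable U ∧ s ≫ p ≠ 0 := by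
      intro A i p hip hi hsp
      have : IsSplitMono i := ⟨⟨⟨p, hip⟩⟩⟩
      have h1 := gr_len_mono (hlen A) (hlen W) i
      have h2 : len A < len W := by
        by_contra h
        exact hi (h1.2 (by omega))
      obtain ⟨U, j, q, hjq, hU, hsq⟩ := ih (len A) (by omega) A T (s ≫ p) le_rfl hsp
      exact ⟨U, j ≫ i, p ≫ q, by simp [reassoc_of% hip, hjq], hU, by simpa using hsq⟩
    by_cases h1 : s ≫ e.hom ≫ biprod.fst = 0
    · refine main B (biprod.inr ≫ e.inv) (e.hom ≫ biprod.snd) (by simp) ?_ ?_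
      · intro h
        apply gr_not_iso_inr (B := B) hA
        have : (biprod.inr : B ⟶ A ⊞ B) = (biprod.inr ≫ e.inv) ≫ e.hom := by simp
        rw [this]; infer_instance
      · intro h2
        apply hs
        rw [← cancel_mono e.hom]
        apply biprod.hom_ext <;> simpa
    · refine main A (biprod.inl ≫ e.inv) (e.hom ≫ biprod.fst) (by simp) ?_ h1
      intro h
      apply gr_not_iso_inl (A := A) hB
      have : (biprod.inl : A ⟶ A ⊞ B) = (biprod.inl ≫ e.inv) ≫ e.hom := by simp
      rw [this]; infer_instance

/-- If ranks do not drop in the composite `f ≫ k` through an indecomposable object, then `f` is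
epi and `k` is mono. -/
theorem gr_rank (len : C → ℕ) (hlen : ∀ X, ObjLength X (len X)) {A B D : C}
    (hB : Indecomposable B) (f : A ⟶ B) (k : B ⟶ D) (r : ℕ) (hfk : f ≫ k ≠ 0)
    (h1 : len (image f) ≤ r) (h2 : len (image k) ≤ r) (h3 : r ≤ len (image (f ≫ k))) :
    Epi f ∧ Mono k := by
  let e : image f ⟶ image k := image.ι f ≫ factorThruImage k
  have hfac : (factorThruImage f ≫ factorThruImage e) ≫ (image.ι e ≫ image.ι k) = f ≫ k := by
    simp [e]
  let F : MonoFactorisation (f ≫ k) :=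
    { I := image e, m := image.ι e ≫ image.ι k, e := factorThruImage f ≫ factorThruImage e
      fac := hfac }
  have h4 := (gr_len_mono (hlen _) (hlen _) (image.lift F)).1
  have h4' : len (image (f ≫ k)) ≤ len (image e) := h4
  have i1 : IsIso (factorThruImage e) :=
    (gr_len_epi (hlen _) (hlen _) (factorThruImage e)).2 (by omega)
  have i2 : IsIso (image.ι e) := (gr_len_mono (hlen _) (hlen _) (image.ι e)).2 (by omega)
  have i3 : IsIso e := by rw [← image.fac e]; infer_instance
  have hz : ¬ IsZero (image f) := by
    intro hz
    apply hfk
    rw [← image.fac f, hz.eq_of_src (image.ι f) 0]; simp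
  have i4 : IsIso (image.ι f) := gr_isIso_of_split hB (image.ι f) (factorThruImage k ≫ inv e)
    (by rw [← Category.assoc]; exact IsIso.hom_inv_id e) hz
  have i5 : IsIso (factorThruImage k) := by
    have : factorThruImage k = inv (image.ι f) ≫ e := by simp [e]
    rw [this]; infer_instance
  constructor
  · rw [← image.fac f]; infer_instance
  · rw [← image.fac k]; infer_instance

/-- Harada-Sai: a family `P` of indecomposables of bounded length cannot have the property that
every nonzero map into a member stays nonzero after composing with a suitable non-isomorphism to
another member. -/
theorem gr_haradaSai (len : C → ℕ) (hlen : ∀ X, ObjLength X (len X)) (P : C → Prop) (N : ℕ)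
    (hP : ∀ X, P X → Indecomposable X) (hN : ∀ X, P X → len X ≤ N)
    (step : ∀ (X T : C) (s : T ⟶ X), P X → s ≠ 0 →
      ∃ (U : C) (f : X ⟶ U), P U ∧ ¬ IsIso f ∧ s ≫ f ≠ 0) (m : ℕ) :
    ∀ (X T : C) (s : T ⟶ X), P X → s ≠ 0 →
      ∃ (U : C) (f : X ⟶ U), P U ∧ s ≫ f ≠ 0 ∧ len (image f) + m ≤ N := by
  induction m with
  | zero =>
    intro X T s hX hs
    refine ⟨X, 𝟙 X, hX, by simpa using hs, ?_⟩
    have := (gr_len_mono (hlen _) (hlen _) (image.ι (𝟙 X))).1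
    have := hN X hX
    omega
  | succ m ih =>
    intro X T s hX hs
    obtain ⟨B, f, hB, hsf, hf⟩ := ih X T s hX hs
    obtain ⟨D, g, hD, hg, hsg⟩ := step B T (s ≫ f) hB hsf
    obtain ⟨E, h, hE, hsh, hh⟩ := ih D T ((s ≫ f) ≫ g) hD hsg
    refine ⟨E, f ≫ g ≫ h, hE, by simpa using hsh, ?_⟩
    by_contra hcon
    have hne : f ≫ g ≫ h ≠ 0 := by
      intro h0
      apply hsh
      simp [h0]
    have rk1 : len (image (g ≫ h)) ≤ len (image h) :=
      (gr_len_mono (hlen _) (hlen _) (image.preComp g h)).1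
    have rk2 : len (image (f ≫ g)) ≤ len (image f) := by
      let F : MonoFactorisation (f ≫ g) :=
        { I := image (image.ι f ≫ g), m := image.ι (image.ι f ≫ g)
          e := factorThruImage f ≫ factorThruImage (image.ι f ≫ g)
          fac := by simp }
      have a1 : len (image (f ≫ g)) ≤ len (image (image.ι f ≫ g)) :=
        (gr_len_mono (hlen _) (hlen _) (image.lift F)).1
      have a2 := (gr_len_epi (hlen _) (hlen _) (factorThruImage (image.ι f ≫ g))).1
      omega
    have c1 := gr_rank len hlen (hP B hB) f (g ≫ h) (N - m) hne (by omega) (by omega) (by omega)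
    have c2 := gr_rank len hlen (hP D hD) (f ≫ g) h (N - m) (by simpa using hne)
      (by omega) (by omega) (by rw [Category.assoc]; omega)
    have := c1.2
    have := c2.1
    have : Mono g := mono_of_mono g h
    have : Epi g := epi_of_epi f g
    exact hg (isIso_of_mono_of_epi g)

end Helpers

/-- In an abelian length category, every indecomposable object `Y` which is
not simple fits into a short exact sequence `0 → X → Y → Z → 0` with `X`
and `Z` indecomposable. -/
theorem exists_shortExact_indecomposable_ends
    (hlength : ∀ Z : C, ∃ n : ℕ, ObjLength Z n)
    (Y : C) (hY : Indecomposable Y) (hns : ¬ Simple Y) :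
    ∃ (X Z : C) (f : X ⟶ Y) (g : Y ⟶ Z) (w : f ≫ g = 0),
      (ShortComplex.mk f g w).ShortExact ∧
      Indecomposable X ∧ Indecomposable Z := by
  choose len hlen using hlength
  by_contra hcon
  let P : C → Prop := fun X => Indecomposable X ∧ ∃ f : X ⟶ Y, Mono f ∧ ¬ IsIso f
  -- a summand of a proper subobject is a proper subobject
  have sub : ∀ (U W : C) (i : U ⟶ W) (p : W ⟶ U) (j : W ⟶ Y), i ≫ p = 𝟙 U → Mono j →
      ¬ IsIso j → Indecomposable U → P U := by
    intro U W i p j hip hj hj' hU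
    have : IsSplitMono i := ⟨⟨⟨p, hip⟩⟩⟩
    refine ⟨hU, i ≫ j, inferInstance, fun h => hj' ?_⟩
    have : Epi j := epi_of_epi i j
    exact isIso_of_mono_of_epi j
  have step : ∀ (X T : C) (s : T ⟶ X), P X → s ≠ 0 →
      ∃ (U : C) (f : X ⟶ U), P U ∧ ¬ IsIso f ∧ s ≫ f ≠ 0 := by
    rintro X T s ⟨hX, x, hx, hxi⟩ hs
    have w : x ≫ cokernel.π x = 0 := cokernel.condition x
    have hS : (ShortComplex.mk x (cokernel.π x) w).ShortExact :=
      { exact := ShortComplex.exact_of_g_is_cokernel _ (cokernelIsCokernel x)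
        mono_f := hx
        epi_g := by dsimp; infer_instance }
    have hZ : ¬ Indecomposable (cokernel x) := fun hZ =>
      hcon ⟨X, cokernel x, x, cokernel.π x, w, hS, hX, hZ⟩
    have hZ0 : ¬ IsZero (cokernel x) := by
      intro h
      have : Epi x := Preadditive.epi_of_isZero_cokernel x h
      exact hxi (isIso_of_mono_of_epi x)
    unfold Indecomposable at hZ
    push Not at hZ
    obtain ⟨A, B, e, hA, hB⟩ := hZ hZ0
    have main : ∀ (Z₁ : C) (i : Z₁ ⟶ cokernel x), Mono i → ¬ Epi i →
        (∀ σ : Z₁ ⟶ Y, σ ≫ cokernel.π x ≠ i) →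
        ∃ (U : C) (f : X ⟶ U), P U ∧ ¬ IsIso f ∧ s ≫ f ≠ 0 := by
      intro Z₁ i hi hie hσ
      let a : X ⟶ pullback (cokernel.π x) i := pullback.lift x 0 (by simp)
      have ha : a ≫ pullback.fst _ _ = x := pullback.lift_fst _ _ _
      have : Mono a := by
        have : Mono (a ≫ pullback.fst (cokernel.π x) i) := by rw [ha]; exact hx
        exact mono_of_mono a (pullback.fst _ _)
      have hj : ¬ IsIso (pullback.fst (cokernel.π x) i) := by
        intro h
        apply hie
        have : Epi (pullback.snd (cokernel.π x) i ≫ i) := by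
          rw [← pullback.condition]; infer_instance
        exact epi_of_epi (pullback.snd (cokernel.π x) i) i
      have hsa : s ≫ a ≠ 0 := by
        intro h
        apply hs
        rw [← cancel_mono a, h, zero_comp]
      obtain ⟨U, u, p, hup, hU, hsp⟩ := gr_summand len hlen _ _ _ (s ≫ a) le_rfl hsa
      refine ⟨U, a ≫ p, sub _ _ u p _ hup inferInstance hj hU, ?_, by simpa using hsp⟩
      intro hiso
      obtain ⟨σ, h⟩ := gr_section x (cokernel.π x) w hS i (p ≫ inv (a ≫ p)) (by
        rw [← Category.assoc]; exact IsIso.hom_inv_id (a ≫ p))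
      exact hσ σ h
    have he : ∀ {V : C} (i : V ⟶ A ⊞ B), Epi (i ≫ e.inv) → Epi i := by
      intro V i h
      have : i = (i ≫ e.inv) ≫ e.hom := by simp
      rw [this]; infer_instance
    by_cases h1 : ∃ σ : A ⟶ Y, σ ≫ cokernel.π x = biprod.inl ≫ e.inv
    · by_cases h2 : ∃ σ : B ⟶ Y, σ ≫ cokernel.π x = biprod.inr ≫ e.inv
      · exfalso
        obtain ⟨σ, hσ⟩ := h1
        obtain ⟨τ, hτ⟩ := h2
        let q : cokernel x ⟶ Y := e.hom ≫ biprod.desc σ τ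
        have hq : q ≫ cokernel.π x = 𝟙 _ := by
          have : biprod.desc σ τ ≫ cokernel.π x = e.inv := by
            apply biprod.hom_ext' <;> simp [hσ, hτ]
          simp [q, this]
        have : IsIso q := gr_isIso_of_split hY q _ hq hZ0
        apply hX.1
        have hπ : cokernel.π x = inv q := by
          rw [← cancel_epi q, hq, IsIso.hom_inv_id]
        have hx0 : x = 0 := by
          rw [← cancel_mono (inv q), ← hπ, w, zero_comp]
        rw [IsZero.iff_id_eq_zero, ← cancel_mono x, hx0]; simp
      · push Not at h2
        exact main B (biprod.inr ≫ e.inv) inferInstance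
          (fun h => gr_not_iso_inr hA (he _ h)) h2
    · push Not at h1
      exact main A (biprod.inl ≫ e.inv) inferInstance
        (fun h => gr_not_iso_inl hB (he _ h)) h1
  -- there is a proper indecomposable subobject
  obtain ⟨X, hX⟩ : ∃ X, P X := by
    by_contra hno
    apply hns
    refine ⟨fun {W} f hf => ⟨?_, ?_⟩⟩
    · rintro hi rfl
      apply hY.1
      rw [IsZero.iff_id_eq_zero, ← IsIso.inv_hom_id (0 : W ⟶ Y), comp_zero]
    · intro hf0
      by_contra hi
      obtain ⟨U, u, p, hup, hU, -⟩ := gr_summand len hlen _ W W (𝟙 W) le_rfl (by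
        intro h
        apply hf0
        rw [← Category.id_comp f, h, zero_comp])
      exact hno ⟨U, sub _ _ u p f hup hf hi hU⟩
  have hN : ∀ X, P X → len X ≤ len Y := by
    rintro X ⟨-, x, hx, -⟩
    exact (gr_len_mono (hlen X) (hlen Y) x).1
  obtain ⟨U, f, -, hf, hlenf⟩ := gr_haradaSai len hlen P (len Y + 1) (fun X hX => hX.1)
    (fun X hX => (hN X hX).trans (Nat.le_succ _)) step (len Y + 1) X X (𝟙 X) hX (by
      intro h
      exact hX.1.1 ((IsZero.iff_id_eq_zero X).2 h))
  have hl0 : len (image f) = 0 := by omega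
  have hk : kernel.ι (𝟙 (image f)) = 0 := by
    rw [← Category.comp_id (kernel.ι (𝟙 (image f))), kernel.condition]
  have hki : IsIso (kernel.ι (𝟙 (image f))) :=
    (gr_len_mono (hlen _) (hlen (image f)) (kernel.ι (𝟙 (image f)))).2 (by omega)
  have hz : IsZero (image f) := by
    rw [IsZero.iff_id_eq_zero, ← cancel_epi (kernel.ι (𝟙 (image f))), kernel.condition, comp_zero]
  apply hf
  rw [Category.id_comp, ← image.fac f, hz.eq_of_src (image.ι f) 0, comp_zero]
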